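/- Let 0 < p ≤ 1 and let ‖·‖ be a p-norm on R^d with min_{i=1,…,d} ‖e_i‖ = 1. Let φ(t) = exp(β g(t)) with β > 0, where g: [0,∞) → [0,∞) is monotonically increasing and differentiable with g(0) = 0 and lim_{t→∞} g'(t) t^{1−p} = 0. Consider the weight sequence w(k) = φ(‖k‖), write a_n = a_n(Id: H^{φ(‖·‖)}(T^d) → L2(T^d)) and ε_n = ε_n(id: ℓ_{‖·‖}^d → ℓ_∞^d). Then lim_{n→∞} a_n · φ(1/(2 ε_n)) = 1. -/

import Mathlib

open MeasureTheory Real Filter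
open scoped ENNReal NNReal BigOperators

noncomputable section

/-- The `d`-torus `T^d`, modeled as the cube `[0,2π]^d` with Lebesgue measure. -/
def torusMeasure (d : ℕ) : Measure (Fin d → ℝ) :=
  volume.restrict (Set.univ.pi fun _ => Set.Icc 0 (2 * π))

/-- `L2(T^d)`. -/
abbrev TorusL2 (d : ℕ) := Lp ℂ 2 (torusMeasure d)

/-- The Fourier coefficient `c_k(f) = (2π)^{-d/2} ∫ f(x) e^{-i k·x} dx`. -/
def fourierCoeffT {d : ℕ} (f : TorusL2 d) (k : Fin d → ℤ) : ℂ :=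
  (((2 * π) ^ (-(d : ℝ) / 2) : ℝ) : ℂ) *
    ∫ x, f x * Complex.exp (-Complex.I * ((∑ j, (k j : ℝ) * x j : ℝ) : ℂ)) ∂(torusMeasure d)

/-- The squared `H^w(T^d)` norm `∑_k w(k)^2 |c_k(f)|^2`, valued in `ℝ≥0∞`. -/
def wNormSq {d : ℕ} (w : (Fin d → ℤ) → ℝ) (f : TorusL2 d) : ℝ≥0∞ :=
  ∑' k : Fin d → ℤ, ENNReal.ofReal (w k ^ 2 * ‖fourierCoeffT f k‖ ^ 2)

/-- The `n`-th approximation number `a_n(Id : H^{w₁}(T^d) → H^{w₂}(T^d))`: the infimum of all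
worst-case error bounds `r ≥ 0` achievable by a linear map `A` of rank `< n`, where the error
`‖f - A f‖` is measured in the `H^{w₂}` norm on the unit ball of `H^{w₁}`.
(With `w₂ ≡ 1` this is the approximation error in `L2(T^d)`, by Parseval.) -/
def approxNumber (d : ℕ) (w₁ w₂ : (Fin d → ℤ) → ℝ) (n : ℕ) : ℝ :=
  sInf { r : ℝ | 0 ≤ r ∧
    ∃ A : TorusL2 d →ₗ[ℂ] TorusL2 d,
      Module.Finite ℂ (LinearMap.range A) ∧
      Module.finrank ℂ (LinearMap.range A) < n ∧
      ∀ f : TorusL2 d, wNormSq w₁ f ≤ 1 →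
        wNormSq w₂ (f - A f) ≤ ENNReal.ofReal r ^ 2 }

/-- constant weight `1`, defining `L2(T^d)` as a weighted space. -/
def constOne (d : ℕ) : (Fin d → ℤ) → ℝ := fun _ => 1

/-- The `ℓ_p` (quasi-)norm on `ℝ^d`, for `0 < p ≤ ∞`. -/
def pNorm (d : ℕ) (p : ℝ≥0∞) (x : Fin d → ℝ) : ℝ :=
  if p = ∞ then ⨆ j, |x j| else (∑ j, |x j| ^ p.toReal) ^ (1 / p.toReal)

/-- The isotropic Sobolev weight `w_{s,p}`. -/
def wIso (d : ℕ) (s : ℝ) (p : ℝ≥0∞) (k : Fin d → ℤ) : ℝ :=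
  if p = ∞ then (max 1 (⨆ j, |(k j : ℝ)|)) ^ s
  else (1 + ∑ j, |(k j : ℝ)| ^ p.toReal) ^ (s / p.toReal)

/-- The Gevrey weight `w^G_{α,β,p}(k) = exp(β ‖k‖_p^α)`. -/
def wGevrey (d : ℕ) (α β : ℝ) (p : ℝ≥0∞) (k : Fin d → ℤ) : ℝ :=
  Real.exp (β * pNorm d p (fun j => (k j : ℝ)) ^ α)

/-- The covering number `N_ε(A)`: the minimal number of closed `ℓ_∞`-balls of radius `ε`
needed to cover `A` (note that on `Fin d → ℝ` the canonical metric is the sup-metric). -/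
def coveringNumber {d : ℕ} (ε : ℝ) (A : Set (Fin d → ℝ)) : ℕ∞ :=
  ⨅ (S : Finset (Fin d → ℝ)) (_ : A ⊆ ⋃ x ∈ S, Metric.closedBall x ε), (S.card : ℕ∞)

/-- The (non-dyadic) entropy number `ε_n(A, ℓ_∞^d)`. -/
def entropyNumber {d : ℕ} (n : ℕ) (A : Set (Fin d → ℝ)) : ℝ :=
  sInf { ε : ℝ | 0 < ε ∧ coveringNumber ε A ≤ (n : ℕ∞) }

/-- The grid number `G(A) = #(A ∩ ℤ^d)`. -/
def gridNumber {d : ℕ} (A : Set (Fin d → ℝ)) : ℕ∞ :=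
  (A ∩ {x | ∀ i, ∃ m : ℤ, x i = (m : ℝ)}).encard

/-- The closed unit ball `B_p^d` of `ℓ_p^d`. -/
def unitBallP (d : ℕ) (p : ℝ≥0∞) : Set (Fin d → ℝ) := {x | pNorm d p x ≤ 1}

end

noncomputable section

/-- The orthonormal character `e_k(x) = (2π)^{-d/2} e^{i k·x}` as a function. -/
def torusChar {d : ℕ} (k : Fin d → ℤ) (x : Fin d → ℝ) : ℂ :=
  (((2 * π) ^ (-(d : ℝ) / 2) : ℝ) : ℂ) *
    Complex.exp (Complex.I * ((∑ j, (k j : ℝ) * x j : ℝ) : ℂ))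

instance isFiniteMeasure_torusMeasure (d : ℕ) : IsFiniteMeasure (torusMeasure d) := by
  refine ⟨?_⟩
  rw [torusMeasure, Measure.restrict_apply_univ]
  exact (isCompact_univ_pi fun _ => isCompact_Icc).measure_lt_top

lemma norm_exp_neg_I_mul_ofReal (t : ℝ) : ‖Complex.exp (-Complex.I * (t : ℂ))‖ = 1 := by
  rw [Complex.norm_exp]; simp

lemma memLp_torusChar {d : ℕ} (k : Fin d → ℤ) : MemLp (torusChar k) 2 (torusMeasure d) := by
  refine MemLp.of_bound (C := |(2 * π) ^ (-(d : ℝ) / 2)|) ?_ ?_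
  · apply Continuous.aestronglyMeasurable
    unfold torusChar
    fun_prop
  · refine Eventually.of_forall fun x => ?_
    rw [torusChar, norm_mul, Complex.norm_exp]
    simp

/-- The orthonormal character as an element of `L2(T^d)`. -/
def torusCharLp {d : ℕ} (k : Fin d → ℤ) : TorusL2 d := (memLp_torusChar k).toLp _

lemma integrable_mul_char {d : ℕ} (f : TorusL2 d) (k : Fin d → ℤ) :
    Integrable (fun x => f x *
      Complex.exp (-Complex.I * ((∑ j, (k j : ℝ) * x j : ℝ) : ℂ))) (torusMeasure d) := by
  have hf : Integrable f (torusMeasure d) := (Lp.memLp f).integrable (by norm_num)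
  refine hf.mul_bdd (c := 1) ?_ ?_
  · apply Continuous.aestronglyMeasurable
    fun_prop
  · exact Eventually.of_forall fun x => (norm_exp_neg_I_mul_ofReal _).le

/-- The Fourier coefficient as a linear functional. -/
def fourierCoeffLin {d : ℕ} (k : Fin d → ℤ) : TorusL2 d →ₗ[ℂ] ℂ where
  toFun f := fourierCoeffT f k
  map_add' f g := by
    simp only [fourierCoeffT]
    rw [← mul_add, ← integral_add (integrable_mul_char f k) (integrable_mul_char g k)]
    congr 1
    refine integral_congr_ae ?_
    filter_upwards [Lp.coeFn_add f g] with x hx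
    rw [hx, Pi.add_apply, add_mul]
  map_smul' c f := by
    simp only [fourierCoeffT, RingHom.id_apply, smul_eq_mul]
    rw [mul_left_comm, ← integral_const_mul c]
    congr 1
    refine integral_congr_ae ?_
    filter_upwards [Lp.coeFn_smul c f] with x hx
    rw [hx, Pi.smul_apply, smul_eq_mul, mul_assoc]

lemma fourierCoeffLin_apply {d : ℕ} (k : Fin d → ℤ) (f : TorusL2 d) :
    fourierCoeffLin k f = fourierCoeffT f k := rfl

lemma integral_exp_int_mul (m : ℤ) :
    ∫ x in Set.Icc 0 (2 * π), Complex.exp (Complex.I * ((m : ℝ) * x : ℝ)) =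
      if m = 0 then ((2 * π : ℝ) : ℂ) else 0 := by
  rw [integral_Icc_eq_integral_Ioc, ← intervalIntegral.integral_of_le (by positivity)]
  split_ifs with h
  · simp [h]
  · have hc : (Complex.I * m : ℂ) ≠ 0 := mul_ne_zero Complex.I_ne_zero (by exact_mod_cast h)
    have : ∀ x : ℝ, Complex.exp (Complex.I * ((m : ℝ) * x : ℝ)) =
        Complex.exp (Complex.I * m * x) := fun x => by push_cast; ring_nf
    simp_rw [this]
    rw [integral_exp_mul_complex hc]
    have : Complex.exp (Complex.I * m * (2 * π : ℝ)) = 1 := by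
      rw [Complex.exp_eq_one_iff]
      exact ⟨m, by push_cast; ring⟩
    rw [this]
    simp

lemma integral_torus_exp {d : ℕ} (m : Fin d → ℤ) :
    ∫ x, Complex.exp (Complex.I * ((∑ j, (m j : ℝ) * x j : ℝ) : ℂ)) ∂(torusMeasure d) =
      if m = 0 then (((2 * π) ^ d : ℝ) : ℂ) else 0 := by
  have hprod : ∀ x : Fin d → ℝ, Complex.exp (Complex.I * ((∑ j, (m j : ℝ) * x j : ℝ) : ℂ)) =
      ∏ j, Complex.exp (Complex.I * ((m j : ℝ) * x j : ℝ)) := fun x => by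
    rw [← Complex.exp_sum, ← Finset.mul_sum, Complex.ofReal_sum]
  simp_rw [hprod]
  rw [torusMeasure, volume_pi, Measure.restrict_pi_pi,
    integral_fintype_prod_eq_prod (𝕜 := ℂ)
      (fun (j : Fin d) (t : ℝ) => Complex.exp (Complex.I * ((m j : ℝ) * t : ℝ)))]
  simp_rw [integral_exp_int_mul]
  split_ifs with h
  · subst h
    simp
  · obtain ⟨j, hj⟩ := Function.ne_iff.mp h
    exact Finset.prod_eq_zero (Finset.mem_univ j) (if_neg hj)

lemma fourierCoeffT_torusCharLp {d : ℕ} (k l : Fin d → ℤ) :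
    fourierCoeffT (torusCharLp l) k = if k = l then 1 else 0 := by
  have hae : (fun x => (torusCharLp l : TorusL2 d) x *
        Complex.exp (-Complex.I * ((∑ j, (k j : ℝ) * x j : ℝ) : ℂ))) =ᵐ[torusMeasure d]
      fun x => (((2 * π) ^ (-(d : ℝ) / 2) : ℝ) : ℂ) *
        Complex.exp (Complex.I * ((∑ j, ((l - k) j : ℝ) * x j : ℝ) : ℂ)) := by
    filter_upwards [(memLp_torusChar l).coeFn_toLp] with x hx
    rw [torusCharLp, hx, torusChar, mul_assoc, ← Complex.exp_add]
    congr 2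
    simp only [Pi.sub_apply, Int.cast_sub, sub_mul, Finset.sum_sub_distrib]
    push_cast
    ring
  rw [fourierCoeffT, integral_congr_ae hae, integral_const_mul]
  rw [integral_torus_exp (l - k)]
  by_cases h : k = l
  · subst h
    have hpos : (0 : ℝ) < 2 * π := by positivity
    simp only [sub_self, if_true]
    rw [← Complex.ofReal_mul, ← Complex.ofReal_mul, ← Real.rpow_natCast, ← Real.rpow_add hpos,
      ← Real.rpow_add hpos, ← Complex.ofReal_one]
    congr 1
    rw [← Real.rpow_zero (2 * π)]
    congr 1
    ring
  · rw [if_neg h, if_neg (fun h' => h (sub_eq_zero.mp h').symm), mul_zero, mul_zero]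

lemma fourierCoeffT_sum {d : ℕ} (S : Finset (Fin d → ℤ)) (c : (Fin d → ℤ) → ℂ)
    (k : Fin d → ℤ) :
    fourierCoeffT (∑ l ∈ S, c l • (torusCharLp l : TorusL2 d)) k = if k ∈ S then c k else 0 := by
  rw [← fourierCoeffLin_apply, map_sum]
  simp_rw [map_smul, fourierCoeffLin_apply, fourierCoeffT_torusCharLp, smul_eq_mul, mul_ite,
    mul_one, mul_zero]
  rw [Finset.sum_ite_eq]

/-- The orthogonal projection of `L2(T^d)` onto the characters with frequencies in `S`. -/
def fourierProj {d : ℕ} (S : Finset (Fin d → ℤ)) : TorusL2 d →ₗ[ℂ] TorusL2 d :=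
  ∑ k ∈ S, (fourierCoeffLin k).smulRight (torusCharLp k)

lemma fourierProj_apply {d : ℕ} (S : Finset (Fin d → ℤ)) (f : TorusL2 d) :
    fourierProj S f = ∑ k ∈ S, fourierCoeffT f k • torusCharLp k := by
  simp [fourierProj, fourierCoeffLin_apply]

lemma range_fourierProj_le {d : ℕ} (S : Finset (Fin d → ℤ)) :
    LinearMap.range (fourierProj S) ≤
      Submodule.span ℂ (Set.range fun k : S => (torusCharLp k.1 : TorusL2 d)) := by
  rintro _ ⟨f, rfl⟩
  rw [fourierProj_apply]
  exact Submodule.sum_mem _ fun k hk =>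
    Submodule.smul_mem _ _ (Submodule.subset_span ⟨⟨k, hk⟩, rfl⟩)

lemma fourierCoeffT_sub_fourierProj {d : ℕ} (S : Finset (Fin d → ℤ)) (f : TorusL2 d)
    (k : Fin d → ℤ) :
    fourierCoeffT (f - fourierProj S f) k = if k ∈ S then 0 else fourierCoeffT f k := by
  rw [← fourierCoeffLin_apply, map_sub, fourierProj_apply, fourierCoeffLin_apply,
    fourierCoeffLin_apply, fourierCoeffT_sum]
  split_ifs <;> simp

/-- Projecting onto fewer than `n` frequencies, outside of which the weight is at least `W`,
gives the error `W⁻¹`. -/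
lemma inv_mem_approx_set {d n : ℕ} {w : (Fin d → ℤ) → ℝ} {W : ℝ} (hW : 0 < W)
    (S : Finset (Fin d → ℤ)) (hS : S.card < n) (hw : ∀ k ∉ S, W ≤ w k) :
    W⁻¹ ∈ { r : ℝ | 0 ≤ r ∧
    ∃ A : TorusL2 d →ₗ[ℂ] TorusL2 d,
      Module.Finite ℂ (LinearMap.range A) ∧
      Module.finrank ℂ (LinearMap.range A) < n ∧
      ∀ f : TorusL2 d, wNormSq w f ≤ 1 →
        wNormSq (constOne d) (f - A f) ≤ ENNReal.ofReal r ^ 2 } := by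
  have hfin := FiniteDimensional.span_of_finite ℂ
    (Set.finite_range fun k : S => (torusCharLp k.1 : TorusL2 d))
  refine ⟨by positivity, fourierProj S,
    Submodule.finiteDimensional_of_le (range_fourierProj_le S), ?_, fun f hf => ?_⟩
  · calc _ ≤ _ := Submodule.finrank_mono (range_fourierProj_le S)
      _ ≤ Fintype.card S := finrank_range_le_card _
      _ < n := by simpa using hS
  · calc wNormSq (constOne d) (f - fourierProj S f)
        ≤ ∑' k, ENNReal.ofReal W⁻¹ ^ 2 *
            ENNReal.ofReal (w k ^ 2 * ‖fourierCoeffT f k‖ ^ 2) := by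
          refine ENNReal.tsum_le_tsum fun k => ?_
          rw [fourierCoeffT_sub_fourierProj, ← ENNReal.ofReal_pow (by positivity),
            ← ENNReal.ofReal_mul (by positivity)]
          refine ENNReal.ofReal_le_ofReal ?_
          split_ifs with hk
          · simp only [norm_zero]
            have : 0 ≤ W⁻¹ ^ 2 * (w k ^ 2 * ‖fourierCoeffT f k‖ ^ 2) := by positivity
            simpa using this
          · have h1 : 1 ≤ (W⁻¹ * w k) ^ 2 := by
              refine one_le_pow₀ ?_
              rw [inv_mul_eq_div, one_le_div hW]
              exact hw k hk
            rw [← mul_assoc, ← mul_pow W⁻¹, constOne, one_pow 2]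
            exact mul_le_mul_of_nonneg_right h1 (by positivity)
      _ = ENNReal.ofReal W⁻¹ ^ 2 * wNormSq w f := ENNReal.tsum_mul_left
      _ ≤ ENNReal.ofReal W⁻¹ ^ 2 := mul_le_of_le_one_right' hf

lemma wNormSq_sum {d : ℕ} (w : (Fin d → ℤ) → ℝ) (S : Finset (Fin d → ℤ))
    (c : (Fin d → ℤ) → ℂ) :
    wNormSq w (∑ l ∈ S, c l • (torusCharLp l : TorusL2 d)) =
      ENNReal.ofReal (∑ k ∈ S, w k ^ 2 * ‖c k‖ ^ 2) := by
  rw [wNormSq, tsum_eq_sum (s := S), ENNReal.ofReal_sum_of_nonneg fun k _ => by positivity]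
  · refine Finset.sum_congr rfl fun k hk => ?_
    rw [fourierCoeffT_sum, if_pos hk]
  · intro k hk
    rw [fourierCoeffT_sum, if_neg hk]
    simp

/-- A linear map of rank less than `#S` annihilates a nontrivial trigonometric polynomial with
frequencies in `S`. -/
lemma exists_trigPoly_mem_ker {d : ℕ} (S : Finset (Fin d → ℤ))
    (A : TorusL2 d →ₗ[ℂ] TorusL2 d) [Module.Finite ℂ (LinearMap.range A)]
    (hA : Module.finrank ℂ (LinearMap.range A) < S.card) :
    ∃ c : (Fin d → ℤ) → ℂ, (∃ k ∈ S, c k ≠ 0) ∧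
      A (∑ l ∈ S, c l • (torusCharLp l : TorusL2 d)) = 0 := by
  classical
  let T : (S → ℂ) →ₗ[ℂ] LinearMap.range A :=
    A.rangeRestrict ∘ₗ Fintype.linearCombination ℂ (fun k : S => (torusCharLp k.1 : TorusL2 d))
  have hT : LinearMap.ker T ≠ ⊥ := LinearMap.ker_ne_bot_of_finrank_lt (by simpa using hA)
  obtain ⟨c, hc, hc0⟩ := Submodule.exists_mem_ne_zero_of_ne_bot hT
  obtain ⟨k, hk⟩ := Function.ne_iff.mp hc0
  refine ⟨fun l => if h : l ∈ S then c ⟨l, h⟩ else 0, ⟨k.1, k.2, by simpa using hk⟩, ?_⟩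
  have := congrArg Subtype.val (LinearMap.mem_ker.mp hc)
  simp only [T, LinearMap.comp_apply, LinearMap.codRestrict_apply,
    Fintype.linearCombination_apply, Submodule.coe_zero] at this
  rw [← this, ← Finset.sum_coe_sort S]
  congr 1
  exact Finset.sum_congr rfl fun l _ => by simp

/-- If the weight is at most `W` on at least `n` frequencies, every rank `< n` approximation has
error at least `W⁻¹`. -/
lemma inv_le_of_mem_approx_set {d n : ℕ} {w : (Fin d → ℤ) → ℝ} {W : ℝ} (hW : 0 < W)
    (S : Finset (Fin d → ℤ)) (hS : n ≤ S.card) (hw0 : ∀ k, 0 ≤ w k) (hw : ∀ k ∈ S, w k ≤ W)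
    {r : ℝ} (hr : 0 ≤ r) {A : TorusL2 d →ₗ[ℂ] TorusL2 d}
    (hfin : Module.Finite ℂ (LinearMap.range A))
    (hrank : Module.finrank ℂ (LinearMap.range A) < n)
    (hA : ∀ f : TorusL2 d, wNormSq w f ≤ 1 →
        wNormSq (constOne d) (f - A f) ≤ ENNReal.ofReal r ^ 2) : W⁻¹ ≤ r := by
  obtain ⟨c, ⟨k, hkS, hk⟩, hc⟩ := exists_trigPoly_mem_ker S A (hrank.trans_le hS)
  set M : ℝ := ∑ k ∈ S, ‖c k‖ ^ 2 with hM
  have hM0 : 0 < M := Finset.sum_pos' (fun _ _ => by positivity) ⟨k, hkS, by positivity⟩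
  set a : ℝ := W⁻¹ * (√M)⁻¹ with ha
  have ha0 : 0 < a := by positivity
  have haM : a ^ 2 * M = W⁻¹ ^ 2 := by
    rw [ha, mul_pow, inv_pow (√M), Real.sq_sqrt hM0.le]
    field_simp
  set f : TorusL2 d := ∑ l ∈ S, ((a : ℂ) * c l) • (torusCharLp l : TorusL2 d) with hf
  have hfA : A f = 0 := by
    have : f = (a : ℂ) • ∑ l ∈ S, c l • (torusCharLp l : TorusL2 d) := by
      rw [hf, Finset.smul_sum]
      simp_rw [mul_smul]
    rw [this, map_smul, hc, smul_zero]
  have hnorm : ∀ l, ‖(a : ℂ) * c l‖ ^ 2 = a ^ 2 * ‖c l‖ ^ 2 := fun l => by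
    rw [norm_mul, mul_pow, Complex.norm_real, Real.norm_eq_abs, sq_abs]
  have h1 : wNormSq w f ≤ 1 := by
    rw [hf, wNormSq_sum, ENNReal.ofReal_le_one]
    calc ∑ k ∈ S, w k ^ 2 * ‖(a : ℂ) * c k‖ ^ 2
        ≤ ∑ k ∈ S, W ^ 2 * (a ^ 2 * ‖c k‖ ^ 2) := by
          refine Finset.sum_le_sum fun l hl => ?_
          rw [hnorm]
          have := pow_le_pow_left₀ (hw0 l) (hw l hl) 2
          gcongr
      _ = W ^ 2 * (a ^ 2 * M) := by rw [← Finset.mul_sum, ← Finset.mul_sum]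
      _ = 1 := by rw [haM]; field_simp
      _ ≤ 1 := le_rfl
  have h2 := hA f h1
  rw [hfA, sub_zero, hf, wNormSq_sum, ← ENNReal.ofReal_pow hr,
    ENNReal.ofReal_le_ofReal_iff (by positivity)] at h2
  simp only [constOne, one_pow, one_mul, hnorm] at h2
  rw [← Finset.mul_sum, ← hM, haM] at h2
  exact (pow_le_pow_iff_left₀ (by positivity) hr two_ne_zero).mp h2

/-- If fewer than `n` frequencies have weight less than `W`, and at least `n` frequencies have
weight at most `W`, then the `n`-th approximation number is `W⁻¹`. -/
lemma approxNumber_eq_inv {d n : ℕ} {w : (Fin d → ℤ) → ℝ} {W : ℝ} (hW : 0 < W)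
    (hw0 : ∀ k, 0 ≤ w k)
    (S T : Finset (Fin d → ℤ)) (hS : S.card < n) (hwS : ∀ k ∉ S, W ≤ w k)
    (hT : n ≤ T.card) (hwT : ∀ k ∈ T, w k ≤ W) :
    approxNumber d w (constOne d) n = W⁻¹ := by
  refine IsLeast.csInf_eq ⟨inv_mem_approx_set hW S hS hwS, ?_⟩
  rintro r ⟨hr, A, hfin, hrank, hA⟩
  exact inv_le_of_mem_approx_set hW T hT hw0 hwT hr hfin hrank hA

/-- A `p`-norm on `ℝ^d`. -/
structure IsPNorm {d : ℕ} (p : ℝ) (nrm : (Fin d → ℝ) → ℝ) : Prop where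
  pos : 0 < p
  nonneg : ∀ x, 0 ≤ nrm x
  eq_zero_iff : ∀ x, nrm x = 0 ↔ x = 0
  smul : ∀ (c : ℝ) (x : Fin d → ℝ), nrm (c • x) = |c| * nrm x
  add_rpow_le : ∀ x y, nrm (x + y) ^ p ≤ nrm x ^ p + nrm y ^ p

/-- The real vector with the given integer coordinates. -/
abbrev intVec {d : ℕ} (k : Fin d → ℤ) : Fin d → ℝ := fun i => (k i : ℝ)

/-- The constant `∑ ‖e_i‖^p` comparing a `p`-norm with the maximum norm. -/
def basisSum {d : ℕ} (p : ℝ) (nrm : (Fin d → ℝ) → ℝ) : ℝ := ∑ i, nrm (Pi.single i 1) ^ p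

namespace IsPNorm

variable {d : ℕ} {p : ℝ} {nrm : (Fin d → ℝ) → ℝ}

lemma basisSum_nonneg (h : IsPNorm p nrm) : 0 ≤ basisSum p nrm :=
  Finset.sum_nonneg fun _ _ => Real.rpow_nonneg (h.nonneg _) _

lemma map_zero (h : IsPNorm p nrm) : nrm 0 = 0 := (h.eq_zero_iff 0).mpr rfl

lemma map_neg (h : IsPNorm p nrm) (x : Fin d → ℝ) : nrm (-x) = nrm x := by
  simpa using h.smul (-1) x

lemma sum_rpow_le (h : IsPNorm p nrm) {ι : Type*} (s : Finset ι) (f : ι → Fin d → ℝ) :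
    nrm (∑ i ∈ s, f i) ^ p ≤ ∑ i ∈ s, nrm (f i) ^ p := by
  classical
  induction s using Finset.induction_on with
  | empty => simp [h.map_zero, Real.zero_rpow h.pos.ne']
  | insert a s ha ih =>
    rw [Finset.sum_insert ha, Finset.sum_insert ha]
    exact (h.add_rpow_le _ _).trans (by gcongr)

lemma rpow_le_mul_basisSum (h : IsPNorm p nrm) {x : Fin d → ℝ} {r : ℝ} (hx : ∀ i, |x i| ≤ r) :
    nrm x ^ p ≤ r ^ p * basisSum p nrm := by
  have hsum : x = ∑ i, x i • (Pi.single i 1 : Fin d → ℝ) := by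
    simpa [← Pi.single_smul] using (Finset.univ_sum_single x).symm
  calc nrm x ^ p = nrm (∑ i, x i • (Pi.single i 1 : Fin d → ℝ)) ^ p := by rw [← hsum]
    _ ≤ ∑ i, nrm (x i • (Pi.single i 1 : Fin d → ℝ)) ^ p := h.sum_rpow_le _ _
    _ ≤ ∑ i, r ^ p * nrm (Pi.single i 1) ^ p := by
        refine Finset.sum_le_sum fun i _ => ?_
        rw [h.smul, Real.mul_rpow (abs_nonneg _) (h.nonneg _)]
        have := Real.rpow_nonneg (h.nonneg (Pi.single i 1)) p
        have := Real.rpow_le_rpow (abs_nonneg _) (hx i) h.pos.le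
        gcongr
    _ = _ := by rw [basisSum, Finset.mul_sum]

lemma abs_rpow_sub_rpow_le (h : IsPNorm p nrm) (x y : Fin d → ℝ) :
    |nrm x ^ p - nrm y ^ p| ≤ nrm (x - y) ^ p := by
  have h1 := h.add_rpow_le (x - y) y
  have h2 := h.add_rpow_le (y - x) x
  rw [sub_add_cancel] at h1 h2
  rw [← neg_sub x y, h.map_neg] at h2
  rw [abs_le]
  constructor <;> linarith

lemma continuous_rpow (h : IsPNorm p nrm) : Continuous fun x => nrm x ^ p := by
  rw [continuous_iff_continuousAt]
  intro y
  rw [ContinuousAt, tendsto_iff_dist_tendsto_zero]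
  have hlim : Tendsto (fun x => ‖x - y‖ ^ p * basisSum p nrm) (nhds y) (nhds 0) := by
    have : Continuous fun x => ‖x - y‖ ^ p * basisSum p nrm :=
      ((continuous_id.sub continuous_const).norm.rpow_const fun _ => Or.inr h.pos.le).mul_const _
    have := this.tendsto y
    simpa [Real.zero_rpow h.pos.ne'] using this
  refine squeeze_zero (fun _ => dist_nonneg) (fun x => ?_) hlim
  rw [Real.dist_eq]
  exact (h.abs_rpow_sub_rpow_le x y).trans
    (h.rpow_le_mul_basisSum fun i => norm_le_pi_norm (x - y) i)

/-- A `p`-norm dominates a positive multiple of the maximum norm. -/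
lemma exists_mul_norm_le (h : IsPNorm p nrm) : ∃ m > 0, ∀ x, m * ‖x‖ ≤ nrm x := by
  rcases (Metric.sphere (0 : Fin d → ℝ) 1).eq_empty_or_nonempty with he | hne
  · refine ⟨1, one_pos, fun x => ?_⟩
    have hx : x = 0 := by
      by_contra hx
      have : ‖x‖⁻¹ • x ∈ Metric.sphere (0 : Fin d → ℝ) 1 := by
        simp [norm_smul, norm_ne_zero_iff.mpr hx]
      rw [he] at this
      exact this
    simp [hx, h.nonneg]
  · obtain ⟨y, hy, hmin⟩ :=
      (isCompact_sphere (0 : Fin d → ℝ) 1).exists_isMinOn hne h.continuous_rpow.continuousOn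
    have hy0 : y ≠ 0 := by
      rintro rfl
      simp at hy
    have hypos : 0 < nrm y := (h.nonneg y).lt_of_ne' fun h0 => hy0 ((h.eq_zero_iff y).mp h0)
    refine ⟨nrm y, hypos, fun x => ?_⟩
    rcases eq_or_ne x 0 with rfl | hx
    · simp [h.nonneg]
    have hx' : 0 < ‖x‖ := norm_pos_iff.mpr hx
    have hmem : ‖x‖⁻¹ • x ∈ Metric.sphere (0 : Fin d → ℝ) 1 := by
      simp [norm_smul, hx'.ne']
    have hle : nrm y ^ p ≤ nrm (‖x‖⁻¹ • x) ^ p := hmin hmem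
    have := (Real.rpow_le_rpow_iff (h.nonneg _) (h.nonneg _) h.pos).mp hle
    rw [h.smul, abs_of_pos (inv_pos.mpr hx'), inv_mul_eq_div, le_div_iff₀ hx'] at this
    exact this

lemma finite_intVec_le (h : IsPNorm p nrm) (r : ℝ) :
    {k : Fin d → ℤ | nrm (intVec k) ≤ r}.Finite := by
  obtain ⟨m, hm, hle⟩ := h.exists_mul_norm_le
  refine (Set.finite_Icc (fun _ : Fin d => -⌈r / m⌉) (fun _ => ⌈r / m⌉)).subset fun k hk => ?_
  have hnorm : ‖intVec k‖ ≤ r / m := by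
    rw [le_div_iff₀ hm, mul_comm]
    exact (hle _).trans hk
  have hk' : ∀ i, |(k i : ℝ)| ≤ (⌈r / m⌉ : ℤ) := fun i =>
    ((norm_le_pi_norm (intVec k) i).trans hnorm).trans (Int.le_ceil _)
  exact ⟨fun i => by exact_mod_cast (abs_le.mp (hk' i)).1,
    fun i => by exact_mod_cast (abs_le.mp (hk' i)).2⟩

lemma finite_intVec_lt (h : IsPNorm p nrm) (r : ℝ) :
    {k : Fin d → ℤ | nrm (intVec k) < r}.Finite :=
  (h.finite_intVec_le r).subset fun _ => le_of_lt (a := nrm _)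

/-- The `n`-th smallest norm of an integer vector. -/
lemma exists_nth_norm (h : IsPNorm p nrm) (hd : 0 < d) {n : ℕ} (hn : 0 < n) :
    ∃ r, 0 ≤ r ∧ {k : Fin d → ℤ | nrm (intVec k) < r}.ncard < n ∧
      n ≤ {k : Fin d → ℤ | nrm (intVec k) ≤ r}.ncard := by
  classical
  have : Nonempty (Fin d) := ⟨⟨0, hd⟩⟩
  obtain ⟨T, hT⟩ := Infinite.exists_subset_card_eq (Fin d → ℤ) n
  have hTne : T.Nonempty := Finset.card_pos.mp (hT ▸ hn)
  obtain ⟨k₀, -, hk₀⟩ := T.exists_max_image (fun k => nrm (intVec k)) hTne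
  have hn₀ : n ≤ {k : Fin d → ℤ | nrm (intVec k) ≤ nrm (intVec k₀)}.ncard := by
    rw [← hT, ← Set.ncard_coe_finset T]
    exact Set.ncard_le_ncard (fun k hk => hk₀ k hk) (h.finite_intVec_le _)
  obtain ⟨k₁, ⟨-, hk₁⟩, hmin⟩ := Set.exists_min_image
    {k | nrm (intVec k) ≤ nrm (intVec k₀) ∧
      n ≤ {l : Fin d → ℤ | nrm (intVec l) ≤ nrm (intVec k)}.ncard}
    (fun k => nrm (intVec k)) ((h.finite_intVec_le _).subset fun k hk => hk.1)
    ⟨k₀, le_rfl, hn₀⟩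
  refine ⟨nrm (intVec k₁), h.nonneg _, ?_, hk₁⟩
  by_contra! hcon
  have hfin := h.finite_intVec_lt (nrm (intVec k₁))
  obtain ⟨k₂, hk₂, hmax⟩ := Set.exists_max_image _ (fun k => nrm (intVec k)) hfin
    (Set.nonempty_of_ncard_ne_zero (by omega))
  have hn₂ : n ≤ {l : Fin d → ℤ | nrm (intVec l) ≤ nrm (intVec k₂)}.ncard :=
    hcon.trans (Set.ncard_le_ncard (fun k hk => hmax k hk) (h.finite_intVec_le _))
  have hk₂' : nrm (intVec k₂) < nrm (intVec k₁) := hk₂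
  rcases le_total (nrm (intVec k₂)) (nrm (intVec k₀)) with hle | hle
  · exact absurd (hmin k₂ ⟨hle, hn₂⟩) (not_le.mpr hk₂')
  · exact absurd (hmin k₀ ⟨le_rfl, hn₀⟩) (not_le.mpr (hle.trans_lt hk₂'))

/-- Enlarging a radius by one unit vector adds at least one integer vector. -/
lemma ncard_lt_ncard_of_rpow_add_one_le (h : IsPNorm p nrm) {i : Fin d}
    (hi : nrm (Pi.single i 1) = 1) {r s : ℝ} (hr : 0 ≤ r) (hs : 0 ≤ s) (hrs : r ^ p + 1 ≤ s ^ p) :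
    {k : Fin d → ℤ | nrm (intVec k) ≤ r}.ncard < {k : Fin d → ℤ | nrm (intVec k) ≤ s}.ncard := by
  obtain ⟨k, hk, hmax⟩ := Set.exists_max_image _ (fun k : Fin d → ℤ => k i)
    (h.finite_intVec_le r) ⟨0, by
      have h0 : intVec (0 : Fin d → ℤ) = 0 := funext fun _ => Int.cast_zero
      rwa [Set.mem_ofPred_eq, h0, h.map_zero]⟩
  have hrs' : r ≤ s := (Real.rpow_le_rpow_iff hr hs h.pos).mp (by linarith)
  refine Set.ncard_lt_ncard ⟨fun l hl => le_trans hl hrs', fun hsub => ?_⟩ (h.finite_intVec_le s)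
  have hmem : nrm (intVec (k + Pi.single i 1)) ≤ s := by
    have heq : intVec (k + Pi.single i 1) = intVec k + Pi.single i 1 := by
      ext j
      by_cases hj : j = i
      · subst hj; simp [intVec]
      · simp [intVec, hj]
    rw [heq]
    refine (Real.rpow_le_rpow_iff (h.nonneg _) hs h.pos).mp ((h.add_rpow_le _ _).trans ?_)
    rw [hi, Real.one_rpow]
    have := Real.rpow_le_rpow (h.nonneg _) hk h.pos.le
    linarith
  have := hmax _ (hsub hmem)
  simp at this

/-- Each cube of side less than one contains at most one integer vector. -/
lemma one_div_le_of_coveringNumber_le (h : IsPNorm p nrm) {n : ℕ} {r ε : ℝ} (hr : 0 < r)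
    (hn : n < {k : Fin d → ℤ | nrm (intVec k) ≤ r}.ncard)
    (hε : coveringNumber ε {x | nrm x ≤ 1} ≤ (n : ℕ∞)) : 1 / (2 * r) ≤ ε := by
  by_contra! hlt
  have hlt' : coveringNumber ε {x | nrm x ≤ 1} < ((n + 1 : ℕ) : ℕ∞) :=
    hε.trans_lt (by exact_mod_cast n.lt_succ_self)
  simp only [coveringNumber, iInf_lt_iff] at hlt'
  obtain ⟨S, hS, hcard⟩ := hlt'
  have hcard' : S.card ≤ n := Nat.lt_succ_iff.mp (by exact_mod_cast hcard)
  have hcov : ∀ k : Fin d → ℤ, nrm (intVec k) ≤ r → ∃ x ∈ S, dist (r⁻¹ • intVec k) x ≤ ε := by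
    intro k hk
    have hmem : nrm (r⁻¹ • intVec k) ≤ 1 := by
      rw [h.smul, abs_of_pos (inv_pos.mpr hr), inv_mul_eq_div]
      exact (div_le_one hr).mpr hk
    simpa using hS hmem
  choose! c hcS hc using hcov
  obtain ⟨k, hk, l, hl, hkl, heq⟩ := Set.exists_ne_map_eq_of_ncard_lt_of_maps_to
    (s := {k : Fin d → ℤ | nrm (intVec k) ≤ r}) (t := (S : Set (Fin d → ℝ))) (f := c)
    (by rw [Set.ncard_coe_finset]; omega) (fun k hk => hcS k hk) S.finite_toSet
  refine hkl (funext fun i => ?_)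
  have hdist : dist (r⁻¹ • intVec k) (r⁻¹ • intVec l) < r⁻¹ := by
    calc _ ≤ dist (r⁻¹ • intVec k) (c k) + dist (r⁻¹ • intVec l) (c k) := dist_triangle_right _ _ _
      _ ≤ ε + ε := add_le_add (hc k hk) (heq ▸ hc l hl)
      _ < 1 / (2 * r) + 1 / (2 * r) := add_lt_add hlt hlt
      _ = r⁻¹ := by field_simp; norm_num
  rw [dist_smul₀, Real.norm_of_nonneg (by positivity)] at hdist
  have hone : dist (intVec k) (intVec l) < 1 := by
    have := inv_pos.mpr hr
    nlinarith
  have hi : |(k i : ℝ) - l i| < 1 := (dist_le_pi_dist (intVec k) (intVec l) i).trans_lt hone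
  have hi' : |k i - l i| < 1 := by exact_mod_cast hi
  exact sub_eq_zero.mp (Int.abs_lt_one_iff.mp hi')

/-- Rounding to integer vectors yields a covering of the unit ball. -/
lemma coveringNumber_le_of_rpow_add_lt (h : IsPNorm p nrm) {n : ℕ} {r s : ℝ} (hr : 0 < r)
    (hs : 0 ≤ s) (hrs : r ^ p + basisSum p nrm < s ^ p)
    (hn : {k : Fin d → ℤ | nrm (intVec k) < s}.ncard ≤ n) :
    coveringNumber (1 / (2 * r)) {x | nrm x ≤ 1} ≤ (n : ℕ∞) := by
  classical
  have hfin := h.finite_intVec_lt s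
  rw [Set.ncard_eq_toFinset_card _ hfin] at hn
  refine (iInf₂_le (hfin.toFinset.image fun k => r⁻¹ • intVec k) fun x hx => ?_).trans
    (by exact_mod_cast Finset.card_image_le.trans hn)
  have hx1 : nrm x ≤ 1 := hx
  set k : Fin d → ℤ := fun i => round (r * x i) with hk
  have habs : ∀ i, |(intVec k - r • x) i| ≤ 1 / 2 := fun i => by
    rw [Pi.sub_apply, abs_sub_comm]
    exact abs_sub_round (r * x i)
  have hkn : nrm (intVec k) < s := by
    refine (Real.rpow_lt_rpow_iff (h.nonneg _) hs h.pos).mp ?_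
    have h1 := h.add_rpow_le (intVec k - r • x) (r • x)
    rw [sub_add_cancel, h.smul, abs_of_pos hr] at h1
    have h2 := h.rpow_le_mul_basisSum habs
    have h3 : ((1 : ℝ) / 2) ^ p * basisSum p nrm ≤ basisSum p nrm :=
      mul_le_of_le_one_left h.basisSum_nonneg
        (Real.rpow_le_one (by norm_num) (by norm_num) h.pos.le)
    have h4 : (r * nrm x) ^ p ≤ r ^ p :=
      Real.rpow_le_rpow (mul_nonneg hr.le (h.nonneg _)) (mul_le_of_le_one_right hr.le hx1) h.pos.le
    linarith
  simp only [Set.mem_iUnion, exists_prop]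
  refine ⟨r⁻¹ • intVec k, Finset.mem_image_of_mem _ (hfin.mem_toFinset.mpr hkn), ?_⟩
  rw [Metric.mem_closedBall, dist_pi_le_iff (by positivity)]
  intro i
  have heq : x i - (r⁻¹ • intVec k) i = -(r⁻¹ * (intVec k - r • x) i) := by
    simp only [Pi.smul_apply, Pi.sub_apply, smul_eq_mul]
    field_simp
    ring
  rw [Real.dist_eq, heq, abs_neg, abs_mul, abs_of_pos (inv_pos.mpr hr)]
  calc r⁻¹ * |(intVec k - r • x) i| ≤ r⁻¹ * (1 / 2) := by gcongr; exact habs i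
    _ = 1 / (2 * r) := by field_simp

/-- The inverse entropy number is sandwiched between radii between which the number of integer
vectors passes `n`. -/
lemma le_one_div_entropyNumber_le (h : IsPNorm p nrm) {n : ℕ} {r s t : ℝ} (hr : 0 < r)
    (hs : 0 ≤ s) (hrs : r ^ p + basisSum p nrm < s ^ p)
    (hns : {k : Fin d → ℤ | nrm (intVec k) < s}.ncard ≤ n) (ht : 0 < t)
    (hnt : n < {k : Fin d → ℤ | nrm (intVec k) ≤ t}.ncard) :
    r ≤ 1 / (2 * entropyNumber n {x | nrm x ≤ 1}) ∧
      1 / (2 * entropyNumber n {x | nrm x ≤ 1}) ≤ t := by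
  have hmem : 1 / (2 * r) ∈ {ε : ℝ | 0 < ε ∧ coveringNumber ε {x | nrm x ≤ 1} ≤ (n : ℕ∞)} :=
    ⟨by positivity, h.coveringNumber_le_of_rpow_add_lt hr hs hrs hns⟩
  have hle : entropyNumber n {x | nrm x ≤ 1} ≤ 1 / (2 * r) := csInf_le ⟨0, fun ε hε => hε.1.le⟩ hmem
  have hge : 1 / (2 * t) ≤ entropyNumber n {x | nrm x ≤ 1} :=
    le_csInf ⟨_, hmem⟩ fun ε hε => h.one_div_le_of_coveringNumber_le ht hnt hε.2
  have hpos : 0 < entropyNumber n {x | nrm x ≤ 1} := lt_of_lt_of_le (by positivity) hge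
  constructor
  · rw [le_div_iff₀ (by positivity)] at hle
    rw [le_div_iff₀ (by positivity)]
    linarith
  · rw [div_le_iff₀ (by positivity)] at hge ⊢
    linarith

end IsPNorm

/-- Differences of `g` at points whose `p`-th powers are at bounded distance become small. -/
lemma exists_abs_sub_le_of_abs_rpow_sub_le {p : ℝ} (hp : 0 < p) {g : ℝ → ℝ}
    (hgdiff : ∀ t : ℝ, 0 ≤ t → DifferentiableAt ℝ g t)
    (hg' : Tendsto (fun t : ℝ => deriv g t * t ^ (1 - p)) atTop (nhds 0))
    {K ε : ℝ} (hK : 0 ≤ K) (hε : 0 < ε) :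
    ∃ T : ℝ, ∀ u v, T ≤ u → T ≤ v → |u ^ p - v ^ p| ≤ K → |g u - g v| ≤ ε := by
  set δ : ℝ := ε * p / (K + 1) with hδ
  have hδ0 : 0 < δ := by positivity
  obtain ⟨T₀, hT₀⟩ := (Metric.tendsto_atTop.mp hg') δ hδ0
  set T := max T₀ 1
  have hT1 : 1 ≤ T := le_max_right _ _
  refine ⟨T, fun u v hu hv huv => ?_⟩
  have hu0 : 0 ≤ u := by linarith
  have hv0 : 0 ≤ v := by linarith
  have hderiv : ∀ s ∈ Set.Ici (T ^ p), HasDerivWithinAt (fun s => g (s ^ (1 / p)))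
      (deriv g (s ^ (1 / p)) * (1 / p * s ^ (1 / p - 1))) (Set.Ici (T ^ p)) s := by
    intro s hs
    have hs0 : 0 < s := lt_of_lt_of_le (by positivity) (Set.mem_Ici.mp hs)
    have h1 : HasDerivAt (fun s : ℝ => s ^ (1 / p)) (1 / p * s ^ (1 / p - 1)) s :=
      Real.hasDerivAt_rpow_const (Or.inl hs0.ne')
    exact ((hgdiff _ (by positivity)).hasDerivAt.comp s h1).hasDerivWithinAt
  have hbound : ∀ s ∈ Set.Ici (T ^ p),
      ‖deriv g (s ^ (1 / p)) * (1 / p * s ^ (1 / p - 1))‖ ≤ δ / p := by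
    intro s hs
    have hs' : T ^ p ≤ s := hs
    have hs0 : 0 < s := lt_of_lt_of_le (by positivity) hs'
    have hTs : T ≤ s ^ (1 / p) := by
      rw [one_div]
      exact (Real.le_rpow_inv_iff_of_pos (by linarith) hs0.le hp).mpr hs'
    have h2 := hT₀ (s ^ (1 / p)) ((le_max_left _ _).trans hTs)
    rw [dist_zero_right, ← Real.rpow_mul hs0.le] at h2
    have hexp : 1 / p * (1 - p) = 1 / p - 1 := by field_simp
    rw [hexp] at h2
    rw [mul_left_comm, norm_mul, Real.norm_of_nonneg (by positivity : 0 ≤ 1 / p),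
      one_div_mul_eq_div]
    gcongr
  have hmvt := (convex_Ici (T ^ p)).norm_image_sub_le_of_norm_hasDerivWithin_le hderiv hbound
    (x := v ^ p) (y := u ^ p) (Real.rpow_le_rpow (by linarith) hv hp.le)
    (Real.rpow_le_rpow (by linarith) hu hp.le)
  simp only [one_div, Real.rpow_rpow_inv hu0 hp.ne', Real.rpow_rpow_inv hv0 hp.ne',
    Real.norm_eq_abs] at hmvt
  calc |g u - g v| ≤ δ / p * K := hmvt.trans (by gcongr)
    _ = ε * (K / (K + 1)) := by rw [hδ]; field_simp
    _ ≤ ε := mul_le_of_le_one_right hε.le ((div_le_one (by positivity)).mpr (by linarith))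

/-- for a `p`-norm (`0 < p ≤ 1`) with `min_i ‖e_i‖ = 1` and
`φ(t) = exp(β g(t))` with `g` increasing, differentiable, `g(0)=0`,
`g'(t) t^{1-p} → 0`: `lim_n a_n · φ(1/(2 ε_n)) = 1`. -/
theorem statement10 (d : ℕ) (hd : 0 < d) (p : ℝ) (hp0 : 0 < p) (hp1 : p ≤ 1)
    (nrm : (Fin d → ℝ) → ℝ)
    (hnn : ∀ x, 0 ≤ nrm x)
    (hzero : ∀ x, nrm x = 0 ↔ x = 0)
    (hhom : ∀ (c : ℝ) (x : Fin d → ℝ), nrm (c • x) = |c| * nrm x)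
    (htri : ∀ x y, nrm (x + y) ^ p ≤ nrm x ^ p + nrm y ^ p)
    (hmin1 : ∀ i : Fin d, 1 ≤ nrm (Pi.single i 1))
    (hmin2 : ∃ i : Fin d, nrm (Pi.single i 1) = 1)
    (β : ℝ) (hβ : 0 < β) (g : ℝ → ℝ)
    (hgmono : ∀ a b : ℝ, 0 ≤ a → a ≤ b → g a ≤ g b)
    (hgdiff : ∀ t : ℝ, 0 ≤ t → DifferentiableAt ℝ g t)
    (hg0 : g 0 = 0)
    (hg' : Filter.Tendsto (fun t : ℝ => deriv g t * t ^ (1 - p)) Filter.atTop (nhds 0)) :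
    Filter.Tendsto
      (fun n : ℕ =>
        approxNumber d (fun k => Real.exp (β * g (nrm fun i => (k i : ℝ)))) (constOne d) n *
          Real.exp (β * g (1 / (2 * entropyNumber n {x | nrm x ≤ 1}))))
      Filter.atTop (nhds 1) := by
  have h : IsPNorm p nrm := ⟨hp0, hnn, hzero, hhom, htri⟩
  obtain ⟨i, hi⟩ := hmin2
  have hC := h.basisSum_nonneg
  set C := basisSum p nrm
  have hex : ∀ n : ℕ, ∃ r, 0 < n → 0 ≤ r ∧ {k : Fin d → ℤ | nrm (intVec k) < r}.ncard < n ∧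
      n ≤ {k : Fin d → ℤ | nrm (intVec k) ≤ r}.ncard := fun n => by
    rcases n.eq_zero_or_pos with rfl | hn
    · exact ⟨0, fun h0 => absurd h0 (lt_irrefl 0)⟩
    · exact (h.exists_nth_norm hd hn).imp fun r hr _ => hr
  choose ρ hρ using hex
  have hρtop : Tendsto ρ atTop atTop := by
    refine tendsto_atTop.mpr fun M => ?_
    filter_upwards [eventually_gt_atTop {k : Fin d → ℤ | nrm (intVec k) ≤ M}.ncard] with n hn
    by_contra! hlt
    have hcard := (hρ n (by omega)).2.2
    have := Set.ncard_le_ncard (s := {k : Fin d → ℤ | nrm (intVec k) ≤ ρ n})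
      (t := {k : Fin d → ℤ | nrm (intVec k) ≤ M}) (fun k hk => le_trans hk hlt.le)
      (h.finite_intVec_le M)
    omega
  set R : ℕ → ℝ := fun n => 1 / (2 * entropyNumber n {x | nrm x ≤ 1}) with hR
  have happrox : ∀ n : ℕ, 0 < n →
      approxNumber d (fun k => Real.exp (β * g (nrm fun i => (k i : ℝ)))) (constOne d) n =
        (Real.exp (β * g (ρ n)))⁻¹ := by
    intro n hn
    obtain ⟨h0, hlt, hle⟩ := hρ n hn
    have hfin := h.finite_intVec_le (ρ n)
    have hfin' := h.finite_intVec_lt (ρ n)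
    rw [Set.ncard_eq_toFinset_card _ hfin] at hle
    rw [Set.ncard_eq_toFinset_card _ hfin'] at hlt
    refine approxNumber_eq_inv (Real.exp_pos _) (fun _ => (Real.exp_pos _).le) hfin'.toFinset
      hfin.toFinset hlt (fun k hk => ?_) hle (fun k hk => ?_)
    · have hk' : ρ n ≤ nrm (intVec k) := by simpa using hk
      exact Real.exp_le_exp.mpr (mul_le_mul_of_nonneg_left (hgmono _ _ h0 hk') hβ.le)
    · have hk' : nrm (intVec k) ≤ ρ n := by simpa using hk
      exact Real.exp_le_exp.mpr (mul_le_mul_of_nonneg_left (hgmono _ _ (hnn _) hk') hβ.le)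
  have hsandwich : ∀ᶠ n in atTop, 0 < R n ∧ ρ n ^ p - (C + 1) ≤ R n ^ p ∧
      R n ^ p ≤ ρ n ^ p + 1 := by
    have hlarge := ((tendsto_rpow_atTop hp0).comp hρtop).eventually_gt_atTop (C + 1)
    filter_upwards [hlarge, eventually_gt_atTop 0] with n hnC hn
    obtain ⟨h0, hlt, hle⟩ := hρ n hn
    have hnC' : C + 1 < ρ n ^ p := hnC
    have hr : 0 < ρ n ^ p - (C + 1) := by linarith
    have ht : 0 < ρ n ^ p + 1 := by linarith
    have hrp : ((ρ n ^ p - (C + 1)) ^ p⁻¹) ^ p = ρ n ^ p - (C + 1) :=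
      Real.rpow_inv_rpow hr.le hp0.ne'
    have htp : ((ρ n ^ p + 1) ^ p⁻¹) ^ p = ρ n ^ p + 1 := Real.rpow_inv_rpow ht.le hp0.ne'
    have hr' : 0 < (ρ n ^ p - (C + 1)) ^ p⁻¹ := Real.rpow_pos_of_pos hr _
    have ht' : 0 < (ρ n ^ p + 1) ^ p⁻¹ := Real.rpow_pos_of_pos ht _
    obtain ⟨h1, h2⟩ := h.le_one_div_entropyNumber_le (n := n) hr' h0
      (by rw [hrp]; linarith) hlt.le ht'
      (hle.trans_lt (h.ncard_lt_ncard_of_rpow_add_one_le hi h0 ht'.le (by rw [htp])))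
    have hRpos : 0 < R n := hr'.trans_le h1
    exact ⟨hRpos, hrp ▸ Real.rpow_le_rpow hr'.le h1 hp0.le,
      htp ▸ Real.rpow_le_rpow hRpos.le h2 hp0.le⟩
  have hRtop : ∀ T : ℝ, ∀ᶠ n in atTop, T ≤ R n := by
    intro T
    have hlarge := ((tendsto_rpow_atTop hp0).comp hρtop).eventually_ge_atTop
      (max T 0 ^ p + (C + 1))
    filter_upwards [hlarge, hsandwich] with n hn ⟨hpos, hlow, _⟩
    have hn' : max T 0 ^ p + (C + 1) ≤ ρ n ^ p := hn
    exact (le_max_left T 0).trans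
      ((Real.rpow_le_rpow_iff (le_max_right T 0) hpos.le hp0).mp (by linarith))
  have hdiff : Tendsto (fun n => g (R n) - g (ρ n)) atTop (nhds 0) := by
    refine Metric.tendsto_atTop'.mpr fun ε hε => ?_
    obtain ⟨T, hT⟩ := exists_abs_sub_le_of_abs_rpow_sub_le hp0 hgdiff hg'
      (K := C + 1) (by linarith) (half_pos hε)
    have hev : ∀ᶠ n in atTop, dist (g (R n) - g (ρ n)) 0 < ε := by
      filter_upwards [hsandwich, hRtop T, hρtop.eventually_ge_atTop T] with n ⟨_, h1, h2⟩ h3 h4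
      rw [dist_zero_right, Real.norm_eq_abs]
      exact (hT _ _ h3 h4 (abs_le.mpr ⟨by linarith, by linarith⟩)).trans_lt (half_lt_self hε)
    obtain ⟨N, hN⟩ := eventually_atTop.mp hev
    exact ⟨N, fun n hn => hN n hn.le⟩
  have hlim : Tendsto (fun n => Real.exp (β * (g (R n) - g (ρ n)))) atTop (nhds 1) := by
    simpa [Function.comp_def] using (Real.continuous_exp.tendsto _).comp (hdiff.const_mul β)
  refine hlim.congr' ?_
  filter_upwards [eventually_gt_atTop 0] with n hn
  rw [happrox n hn, ← Real.exp_neg, ← Real.exp_add]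
  congr 1
  simp only [hR]
  ring

end
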